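/- Let X and Y be partially ordered sets and h : X → Y a monotone map with the pseudo-epimorphism property: whenever x ∈ X and h(x) ≤ y ∈ Y, there exists z ≥ x with h(z) = y (Mathlib's PseudoEpimorphism). Let n ≥ 2 and let P be the set of elements of X of depth less than n. Suppose h restricted to P is injective. If a ∈ X has depth exactly n, b ∈ P, and h(a) = h(b), then a < b. -/

import Mathlib

/-!
STATEMENT 15: Let `h : X → Y` be a monotone map of posets with the
pseudo-epimorphism property (Mathlib's `PseudoEpimorphism`), `n ≥ 2`, and `P` the
set of elements of `X` of depth less than `n`. If `h` is injective on `P`,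
`a ∈ X` has depth exactly `n`, `b ∈ P` and `h a = h b`, then `a < b`.
-/

universe u v

/-- `ChainFrom p k`: there is a strictly increasing chain of `k` elements
starting at `p`. -/
def ChainFrom {X : Type*} [Preorder X] (p : X) (k : ℕ) : Prop :=
  ∃ q : Fin k → X, StrictMono q ∧ ∀ h : 0 < k, q ⟨0, h⟩ = p

/-- `HasDepth p n`: there is a chain `p = p₁ < ⋯ < pₙ` and no chain
`p = q₁ < ⋯ < q_{n+1}` (so `p` has depth `n`; only meaningful for `n ≥ 1`). -/
def HasDepth {X : Type*} [Preorder X] (p : X) (n : ℕ) : Prop :=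
  0 < n ∧ ChainFrom p n ∧ ¬ ChainFrom p (n + 1)

namespace ChainFrom

variable {X : Type*} [Preorder X] {p q : X} {j k : ℕ}

theorem mono (hp : ChainFrom p k) (hjk : j ≤ k) : ChainFrom p j := by
  obtain ⟨f, hf, hf0⟩ := hp
  exact ⟨f ∘ Fin.castLE hjk, hf.comp (Fin.strictMono_castLE hjk),
    fun h0 => hf0 (h0.trans_le hjk)⟩

theorem cons (hpq : p < q) (hq : ChainFrom q k) : ChainFrom p (k + 1) := by
  obtain ⟨f, hf, hf0⟩ := hq
  refine ⟨Fin.cons p f, ?_, fun _ => rfl⟩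
  intro x y hxy
  induction y using Fin.cases with
  | zero => exact absurd hxy (Fin.not_lt_zero x)
  | succ y =>
    induction x using Fin.cases with
    | zero =>
      have hk : 0 < k := (Nat.zero_le _).trans_lt y.isLt
      simp only [Fin.cons_zero, Fin.cons_succ]
      exact hpq.trans_le ((hf0 hk).symm.le.trans (hf.monotone (Nat.zero_le y.val)))
    | succ x => simpa using hf (Fin.succ_lt_succ_iff.mp hxy)

theorem exists_lt (hp : ChainFrom p (k + 2)) : ∃ q, p < q ∧ ChainFrom q (k + 1) := by
  obtain ⟨f, hf, hf0⟩ := hp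
  refine ⟨f 1, (hf0 (by lia)).symm.trans_lt (hf (Fin.mk_lt_mk.mpr Nat.one_pos)),
    f ∘ Fin.succ, hf.comp Fin.strictMono_succ, fun _ => rfl⟩

theorem one (p : X) : ChainFrom p 1 :=
  ⟨fun _ => p, Subsingleton.strictMono _, fun _ => rfl⟩

theorem of_le {X : Type*} [PartialOrder X] {p q : X} {k : ℕ} (hpq : p ≤ q)
    (hq : ChainFrom q k) : ChainFrom p k := by
  rcases hpq.eq_or_lt with rfl | hlt
  · exact hq
  · exact (hq.cons hlt).mono k.le_succ

end ChainFrom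

theorem exists_hasDepth_lt_iff {X : Type*} [Preorder X] {p : X} {n : ℕ} :
    (∃ m < n, HasDepth p m) ↔ ¬ ChainFrom p n := by
  classical
  refine ⟨fun ⟨m, hmn, _, _, hm⟩ hp => hm (hp.mono hmn), fun hp => ?_⟩
  have hex : ∃ k, ¬ ChainFrom p k := ⟨n, hp⟩
  have hspec := Nat.find_spec hex
  have hle := Nat.find_min' hex hp
  have hgt : 1 < Nat.find hex := by
    by_contra hlt
    exact hspec ((ChainFrom.one p).mono (by lia))
  refine ⟨Nat.find hex - 1, by lia, by lia,
    not_not.mp (Nat.find_min hex (by lia)), ?_⟩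
  rwa [Nat.sub_add_cancel hgt.le]

theorem depth_lt_of_pseudoEpi {X : Type u} {Y : Type v}
    [PartialOrder X] [PartialOrder Y]
    (h : PseudoEpimorphism X Y)
    (n : ℕ) (hn : 2 ≤ n)
    (P : Set X) (hP : P = {x : X | ∃ m < n, HasDepth x m})
    (hinj : Set.InjOn h P)
    (a : X) (ha : HasDepth a n) (b : X) (hb : b ∈ P) (hab : h a = h b) :
    a < b := by
  simp only [exists_hasDepth_lt_iff] at hP
  subst hP
  obtain ⟨k, rfl⟩ := Nat.exists_eq_add_of_le' hn
  obtain ⟨-, hchain, hmax⟩ := ha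
  obtain ⟨c, hac, hc⟩ := hchain.exists_lt
  obtain ⟨z, hbz, hz⟩ := h.exists_map_eq_of_map_le' (a := b) (b := h c)
    (hab.symm.trans_le (h.monotone' hac.le))
  obtain rfl : z = c :=
    hinj (fun hzn => hb (hzn.of_le hbz)) (fun hcn => hmax (hcn.cons hac)) hz
  rcases hbz.eq_or_lt with rfl | hlt
  · exact hac
  · exact absurd (hc.cons hlt) hb
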